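/- Let C be a set of integers such that C_+ = C ∩ ℕ is infinite, and write ℕ \ C = {c̄_1 < c̄_2 < c̄_3 < ...}. Suppose there exists ℓ > 0 such that for every m ∈ ℕ, one has c̄_j − c̄_i ∉ [ℓ, m] for all sufficiently large i and all j > i. Then C does not arise as a minimal additive complement in the integers. -/

import Mathlib

open Pointwise

/-- `C` is a minimal additive complement to `W` in `ℤ`. -/
def MinAddComp (C W : Set ℤ) : Prop :=
  C + W = Set.univ ∧ ∀ C' : Set ℤ, C' ⊂ C → C' + W ≠ Set.univ

/-- Every element `c` of a minimal additive complement is needed to represent some integer `n`. -/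
lemma MinAddComp.exists_unique_representation {C W : Set ℤ} (h : MinAddComp C W) {c : ℤ}
    (hc : c ∈ C) : ∃ n : ℤ, n - c ∈ W ∧ ∀ w ∈ W, n - w ∈ C → n - w = c := by
  have hss : C \ {c} ⊂ C := Set.sdiff_singleton_ssubset.2 hc
  obtain ⟨n, hn⟩ := (Set.ne_univ_iff_exists_notMem _).1 (h.2 _ hss)
  have key : ∀ w ∈ W, n - w ∈ C → n - w = c := by
    intro w hw hwC
    by_contra hne
    exact hn (Set.mem_add.2 ⟨n - w, ⟨hwC, hne⟩, w, hw, by ring⟩)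
  refine ⟨n, ?_, key⟩
  have hnm : n ∈ C + W := h.1 ▸ Set.mem_univ n
  obtain ⟨d, hd, w, hw, hdw⟩ := Set.mem_add.1 hnm
  have hd' : n - w = d := by omega
  have := key w hw (hd' ▸ hd)
  rwa [show n - c = w by omega]

/-- If the pairwise differences of large elements outside `C` eventually avoid every interval
`[l, m]`, then any `W` to which `C` is a minimal additive complement is bounded below. -/
lemma MinAddComp.bddBelow {C W : Set ℤ} (h : MinAddComp C W) (hC : ¬ BddAbove C) {l : ℤ}
    (hgap : ∀ m : ℤ, ∃ N : ℤ, ∀ a b : ℤ, N ≤ a → N ≤ b → a ∉ C → b ∉ C →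
      l ≤ b - a → b - a ≤ m → False) : BddBelow W := by
  by_contra hW
  choose! f hfW hf using fun c (hc : c ∈ C) => h.exists_unique_representation hc
  have hinj : Set.InjOn f C := by
    intro c hc d hd hcd
    have h1 := hf d hd (f c - c) (hfW c hc) (by rwa [← hcd, sub_sub_cancel])
    omega
  have hCinf : C.Infinite := fun hfin => hC hfin.bddAbove
  have himg : (f '' C).Infinite := hCinf.image hinj
  obtain ⟨c, hc⟩ := hCinf.nonempty
  have : ∃ d ∈ C, f d ∉ Set.Icc (f c - l) (f c + l) := by
    by_contra! hcon
    exact himg ((Set.finite_Icc (f c - l) (f c + l)).subset (Set.image_subset_iff.2 hcon))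
  obtain ⟨d, hd, hdc⟩ := this
  obtain ⟨N, hN⟩ := hgap |f d - f c|
  have hlow : ∃ w ∈ W, w < min (f c) (f d) - max N (max c d) := by
    by_contra! hcon
    exact hW ⟨_, hcon⟩
  obtain ⟨w, hw, hwlt⟩ := hlow
  have h1 : f c - w ∉ C := fun hmem => by have := hf c hc w hw hmem; omega
  have h2 : f d - w ∉ C := fun hmem => by have := hf d hd w hw hmem; omega
  rw [Set.mem_Icc, not_and_or, not_le, not_le] at hdc
  rcases hdc with hlt | hlt
  · refine hN (f d - w) (f c - w) (by omega) (by omega) h2 h1 (by omega) ?_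
    have := neg_abs_le (f d - f c)
    omega
  · refine hN (f c - w) (f d - w) (by omega) (by omega) h1 h2 (by omega) ?_
    have := le_abs_self (f d - f c)
    omega

/-- If the pairwise differences of large elements outside `C` eventually avoid every interval
`[l, m]`, then any `W` to which `C` is a minimal additive complement is finite. -/
lemma MinAddComp.finite {C W : Set ℤ} (h : MinAddComp C W) (hC : ¬ BddAbove C) {l : ℕ}
    (hgap : ∀ m : ℤ, ∃ N : ℤ, ∀ a b : ℤ, N ≤ a → N ≤ b → a ∉ C → b ∉ C →
      (l : ℤ) ≤ b - a → b - a ≤ m → False) : W.Finite := by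
  obtain ⟨B, hB⟩ := h.bddBelow hC hgap
  by_contra hW
  obtain ⟨F, hFW, hFcard⟩ := Set.Infinite.exists_subset_card_eq hW (l + 2)
  obtain ⟨K, hK⟩ := F.finite_toSet.bddAbove
  obtain ⟨N, hN⟩ := hgap (K - B)
  obtain ⟨c, hc, hcN⟩ := not_bddAbove_iff.1 hC (N + K - B)
  obtain ⟨n, hnW, hn⟩ := h.exists_unique_representation hc
  have hnB := hB hnW
  have hcard : l + 1 ≤ (F.erase (n - c)).card := by
    have := Finset.pred_card_le_card_erase (s := F) (a := n - c)
    omega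
  have hne : (F.erase (n - c)).Nonempty := Finset.card_pos.1 (by omega)
  set x := (F.erase (n - c)).min' hne
  set y := (F.erase (n - c)).max' hne
  have hxy : l + 1 ≤ (Finset.Icc x y).card :=
    hcard.trans (Finset.card_le_card fun z hz =>
      Finset.mem_Icc.2 ⟨Finset.min'_le _ _ hz, Finset.le_max' _ _ hz⟩)
  rw [Int.card_Icc] at hxy
  have bound : ∀ z ∈ F.erase (n - c), B ≤ z ∧ z ≤ K ∧ n - z ∉ C := by
    intro z hz
    obtain ⟨hzne, hzF⟩ := Finset.mem_erase.1 hz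
    refine ⟨hB (hFW hzF), hK hzF, fun hmem => hzne ?_⟩
    have := hn z (hFW hzF) hmem
    omega
  obtain ⟨hx1, hx2, hx3⟩ := bound x (Finset.min'_mem _ _)
  obtain ⟨hy1, hy2, hy3⟩ := bound y (Finset.max'_mem _ _)
  exact hN (n - y) (n - x) (by omega) (by omega) hy3 hx3 (by omega) (by omega)

/-- Let `C ⊆ ℤ` with `C ∩ ℕ` infinite, and let `ℕ \ C = {cbar 0 < cbar 1 < ⋯}`.
If there exists `l > 0` such that for every `m`, `cbar j - cbar i ∉ [l, m]` for all
sufficiently large `i` and all `j > i`, then `C` does not arise as a minimal additive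
complement in `ℤ`. -/
theorem stmt4 (C : Set ℤ) (hinf : {n : ℕ | (n : ℤ) ∈ C}.Infinite)
    (cbar : ℕ → ℕ) (hcbar : StrictMono cbar)
    (hrange : Set.range cbar = {n : ℕ | (n : ℤ) ∉ C})
    (hl : ∃ l : ℕ, 0 < l ∧ ∀ m : ℕ, ∃ i₀ : ℕ, ∀ i ≥ i₀, ∀ j > i,
      cbar j - cbar i ∉ Set.Icc l m) :
    ¬ ∃ W : Set ℤ, MinAddComp C W := by
  rintro ⟨W, h⟩
  obtain ⟨l, hlpos, hl⟩ := hl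
  have hmem : ∀ i, (cbar i : ℤ) ∉ C := fun i => by
    have : cbar i ∈ {n : ℕ | (n : ℤ) ∉ C} := hrange ▸ Set.mem_range_self i
    exact this
  have hsurj : ∀ a : ℤ, 0 ≤ a → a ∉ C → ∃ i, (cbar i : ℤ) = a := by
    intro a ha haC
    lift a to ℕ using ha
    have : a ∈ Set.range cbar := by rw [hrange]; exact haC
    obtain ⟨i, hi⟩ := this
    exact ⟨i, by rw [hi]⟩
  have hgap : ∀ m : ℤ, ∃ N : ℤ, ∀ a b : ℤ, N ≤ a → N ≤ b → a ∉ C → b ∉ C →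
      (l : ℤ) ≤ b - a → b - a ≤ m → False := by
    intro m
    obtain ⟨i₀, hi₀⟩ := hl m.toNat
    refine ⟨cbar i₀, fun a b ha hb haC hbC hab hba => ?_⟩
    obtain ⟨i, rfl⟩ := hsurj a (by omega) haC
    obtain ⟨j, rfl⟩ := hsurj b (by omega) hbC
    have hi : i₀ ≤ i := hcbar.le_iff_le.1 (by omega)
    have hj : i < j := hcbar.lt_iff_lt.1 (by omega)
    exact hi₀ i hi j hj ⟨by omega, by omega⟩
  have hC : ¬ BddAbove C := by
    rintro ⟨B, hB⟩
    refine hinf ((Set.finite_Iic B.toNat).subset fun n (hn : (n : ℤ) ∈ C) => ?_)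
    have := hB hn
    rw [Set.mem_Iic]
    omega
  have hW := h.finite hC hgap
  obtain ⟨A, hA⟩ := hW.bddBelow
  obtain ⟨B, hB⟩ := hW.bddAbove
  obtain ⟨N, hN⟩ := hgap (l + 2 * |B - A|)
  have hq : N ≤ cbar N.toNat := by
    have := hcbar.le_apply (x := N.toNat)
    omega
  set q : ℤ := (cbar N.toNat : ℤ)
  have hqC : ∀ b : ℤ, q + l ≤ b → b ≤ q + l + 2 * |B - A| → b ∈ C := by
    intro b h1 h2
    by_contra hb
    exact hN q b hq (by omega) (hmem _) hb (by omega) (by omega)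
  have habs := le_abs_self (B - A)
  have habs0 := abs_nonneg (B - A)
  obtain ⟨n, hnW, hn⟩ := h.exists_unique_representation
    (hqC (q + l + |B - A|) (by omega) (by omega))
  have hnA := hA hnW
  have hnB := hB hnW
  have huniq : ∀ w ∈ W, n - w = q + l + |B - A| := by
    intro w hw
    have hwA := hA hw
    have hwB := hB hw
    exact hn w hw (hqC _ (by omega) (by omega))
  have hrep : (cbar 0 : ℤ) + (n - (q + l + |B - A|)) ∈ C + W := h.1 ▸ Set.mem_univ _
  obtain ⟨d, hd, w, hw, hdw⟩ := Set.mem_add.1 hrep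
  have := huniq w hw
  exact hmem 0 (by rwa [show (cbar 0 : ℤ) = d by omega])
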